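/- Let p ≥ 5 be a prime, let k be a positive integer, and let F ∈ ℤ_(p)[Q,R] be isobaric of weight k and not involving P. Then v(D^{p²}F) ≥ 2; that is, D^{p²}F lies in the square (A^p, p)² of the ideal (A^p, p) of ℤ_(p)[P,Q,R]. -/

import Mathlib

open MvPolynomial Finset

noncomputable section

/-- `x` lies in `ℤ_(p) ⊆ ℚ`: `p` does not divide the reduced denominator of `x`. -/
def pInt (p : ℕ) (x : ℚ) : Prop := ¬ p ∣ x.den

/-- The polynomial ring `ℚ[P,Q,R]`, with `P = X 0`, `Q = X 1`, `R = X 2`. -/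
abbrev Poly3 : Type := MvPolynomial (Fin 3) ℚ

/-- `f` has all of its coefficients in `ℤ_(p)`. -/
def polyPInt (p : ℕ) (f : Poly3) : Prop := ∀ m : Fin 3 →₀ ℕ, pInt p (coeff m f)

/-- `f` is isobaric of weight `w`, where `P, Q, R` have weights `2, 4, 6`. -/
def Isobaric (w : ℕ) (f : Poly3) : Prop :=
  ∀ m ∈ f.support, 2 * m 0 + 4 * m 1 + 6 * m 2 = w

/-- `f` does not involve the variable `P`. -/
def NoP (f : Poly3) : Prop := ∀ m ∈ f.support, m 0 = 0

/-- The Ramanujan derivation `D` on `ℚ[P,Q,R]`, the unique derivation with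
`DP = (P²-Q)/12`, `DQ = (PQ-R)/3`, `DR = (PR-Q²)/2`. -/
def Dop (f : Poly3) : Poly3 :=
  C (1/12 : ℚ) * (X 0 ^ 2 - X 1) * pderiv 0 f
    + C (1/3 : ℚ) * (X 0 * X 1 - X 2) * pderiv 1 f
    + C (1/2 : ℚ) * (X 0 * X 2 - X 1 ^ 2) * pderiv 2 f

/-- The sum of the `j`-th powers of the divisors of `n`, as a rational number. -/
def sigmaQ (j n : ℕ) : ℚ := ∑ d ∈ n.divisors, (d : ℚ) ^ j

/-- The q-expansion of `E₂`. -/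
def E2s : PowerSeries ℚ := PowerSeries.mk fun n => if n = 0 then 1 else -24 * sigmaQ 1 n

/-- The q-expansion of `E₄`. -/
def E4s : PowerSeries ℚ := PowerSeries.mk fun n => if n = 0 then 1 else 240 * sigmaQ 3 n

/-- The q-expansion of `E₆`. -/
def E6s : PowerSeries ℚ := PowerSeries.mk fun n => if n = 0 then 1 else -504 * sigmaQ 5 n

/-- The q-expansion of the normalized Eisenstein series `E_{p-1}`. -/
def EAs (p : ℕ) : PowerSeries ℚ :=
  PowerSeries.mk fun n => if n = 0 then 1 else
    -(2 * ((p : ℚ) - 1) / bernoulli (p - 1)) * sigmaQ (p - 2) n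

/-- The q-expansion of the normalized Eisenstein series `E_{p+1}`. -/
def EBs (p : ℕ) : PowerSeries ℚ :=
  PowerSeries.mk fun n => if n = 0 then 1 else
    -(2 * ((p : ℚ) + 1) / bernoulli (p + 1)) * sigmaQ p n

/-- `Φ : ℚ[P,Q,R] → ℚ[[q]]`, the algebra map sending `P, Q, R` to `E₂, E₄, E₆`. -/
def Phi : Poly3 →ₐ[ℚ] PowerSeries ℚ := aeval ![E2s, E4s, E6s]

/-- The theta operator attached to the polynomials `A` and `B`:
`θf = ((BQ-AR)/3)·∂f/∂Q + ((BR-AQ²)/2)·∂f/∂R`. -/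
def thetaOp (A B f : Poly3) : Poly3 :=
  C (1/3 : ℚ) * (B * X 1 - A * X 2) * pderiv 1 f
    + C (1/2 : ℚ) * (B * X 2 - A * X 1 ^ 2) * pderiv 2 f

/-- `f` lies in the `n`-th power of the ideal `(A^p, p)` of `ℤ_(p)[P,Q,R]`. -/
def InIdealPow (p : ℕ) (A : Poly3) (n : ℕ) (f : Poly3) : Prop :=
  ∃ G : ℕ → Poly3, (∀ i, polyPInt p (G i)) ∧
    f = ∑ i ∈ Finset.range (n + 1), (p : Poly3) ^ (n - i) * A ^ (p * i) * G i


section Ramanujan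
open UpperHalfPlane hiding I
open Complex ModularForm EisensteinSeries Derivative Filter
open scoped MatrixGroups Manifold Real

/-- `F` has `q`-expansion `c`. -/
def HasQ (c : PowerSeries ℂ) (F : ℍ → ℂ) : Prop :=
  ∀ z : ℍ, HasSum (fun m : ℕ => PowerSeries.coeff m c * cexp (2 * π * I * z) ^ m) (F z)

lemma HasQ.add {c d : PowerSeries ℂ} {F G : ℍ → ℂ} (hF : HasQ c F) (hG : HasQ d G) :
    HasQ (c + d) (fun z => F z + G z) := by
  intro z
  simpa [add_mul] using (hF z).add (hG z)

lemma HasQ.smul {c : PowerSeries ℂ} {F : ℍ → ℂ} (a : ℂ) (hF : HasQ c F) :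
    HasQ (PowerSeries.C a * c) (fun z => a * F z) := by
  intro z
  simpa [mul_assoc] using (hF z).mul_left a

lemma HasQ.mul {c d : PowerSeries ℂ} {F G : ℍ → ℂ} (hF : HasQ c F) (hG : HasQ d G) :
    HasQ (c * d) (fun z => F z * G z) := by
  intro z
  have h1 := (hF z).summable.norm
  have h2 := (hG z).summable.norm
  have hs := (summable_norm_sum_mul_antidiagonal_of_summable_norm h1 h2).of_norm
  have ht := tsum_mul_tsum_eq_tsum_sum_antidiagonal_of_summable_norm h1 h2
  rw [(hF z).tsum_eq, (hG z).tsum_eq] at ht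
  change HasSum _ (F z * G z)
  have hfe : (fun m : ℕ => PowerSeries.coeff m (c * d) * cexp (2 * π * I * z) ^ m) =
      fun n => ∑ kl ∈ antidiagonal n, (PowerSeries.coeff kl.1 c * cexp (2 * π * I * z) ^ kl.1) *
        (PowerSeries.coeff kl.2 d * cexp (2 * π * I * z) ^ kl.2) := by
    funext m
    rw [PowerSeries.coeff_mul, Finset.sum_mul]
    refine Finset.sum_congr rfl fun x hx => ?_
    rw [← Finset.HasAntidiagonal.mem_antidiagonal.mp hx, pow_add]
    ring
  rw [hfe, ht]
  exact hs.hasSum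

lemma HasQ.eq_zero {c : PowerSeries ℂ} (h : HasQ c (fun _ => 0)) : c = 0 := by
  ext m
  have := ModularFormClass.qExpansion_coeff_unique (f := (0 : ModularForm 𝒮ℒ 4))
    (c := fun m => PowerSeries.coeff m c) one_pos one_mem_strictPeriods_SL (fun z => by
      simpa [Function.Periodic.qParam] using h z) m
  simpa [UpperHalfPlane.qExpansion_zero] using this

lemma norm_cexp_z (w : ℂ) : ‖cexp (2 * π * I * w)‖ = Real.exp (-2 * π * w.im) := by
  rw [Complex.norm_exp]; congr 1; simp

lemma HasQ.deriv {c : PowerSeries ℂ} {F : ℍ → ℂ} (hF : HasQ c F) :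
    HasQ (PowerSeries.mk fun m => m * PowerSeries.coeff m c) (normalizedDerivOfComplex F) := by
  intro z
  have hz := z.im_pos
  set a : ℝ := z.im / 2 with ha
  set b : ℝ := z.im / 4 with hb
  have hbpos : 0 < b := by positivity
  set r : ℝ := Real.exp (-2 * π * a)
  set r' : ℝ := Real.exp (-2 * π * b)
  let zb : ℍ := ⟨I * b, by simpa using hbpos⟩
  have hsb := (hF zb).summable
  have hbd : ∃ M : ℝ, ∀ n, ‖PowerSeries.coeff n c‖ * r' ^ n ≤ M := by
    have h0 := hsb.tendsto_atTop_zero.norm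
    obtain ⟨M, hM⟩ := h0.bddAbove_range
    refine ⟨M, fun n => ?_⟩
    have := hM ⟨n, rfl⟩
    simp only [norm_mul, norm_pow, norm_cexp_z] at this
    simpa [zb, r'] using this
  obtain ⟨M, hM⟩ := hbd
  have hrr : r / r' < 1 := by
    rw [div_lt_one (Real.exp_pos _)]
    apply Real.exp_lt_exp.mpr
    have := Real.pi_pos
    nlinarith
  have hr0 : 0 ≤ r / r' := by positivity
  have hr'pos : 0 < r' := Real.exp_pos _
  let u : ℕ → ℝ := fun n => (2 * π * M) * ((n:ℝ) ^ 1 * (r / r') ^ n)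
  have hu : Summable u := by
    apply Summable.mul_left
    exact summable_pow_mul_geometric_of_norm_lt_one 1 (by rwa [Real.norm_of_nonneg hr0])
  let t : Set ℂ := {w | a < w.im}
  have hto : IsOpen t := isOpen_lt continuous_const continuous_im
  have htc : IsPreconnected t := (convex_halfSpace_im_gt a).isPreconnected
  let g : ℕ → ℂ → ℂ := fun n w => PowerSeries.coeff n c * cexp (2 * π * I * w) ^ n
  let g' : ℕ → ℂ → ℂ := fun n w => (2 * π * I) * (n * PowerSeries.coeff n c * cexp (2 * π * I * w) ^ n)
  have hg : ∀ n y, y ∈ t → HasDerivAt (g n) (g' n y) y := by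
    intro n y _
    have h1 : HasDerivAt (fun w : ℂ => cexp (2 * π * I * w)) (cexp (2 * π * I * y) * (2 * π * I * 1)) y :=
      ((hasDerivAt_id y).const_mul (2 * π * I)).cexp
    have h2 := (h1.pow n).const_mul (PowerSeries.coeff n c)
    refine h2.congr_deriv ?_
    rcases n with _ | n
    · simp [g']
    · simp only [g', Nat.add_sub_cancel, pow_succ]; ring
  have hg' : ∀ n y, y ∈ t → ‖g' n y‖ ≤ u n := by
    intro n y hy
    have hy' : ‖cexp (2 * π * I * y)‖ ≤ r := by
      rw [norm_cexp_z]
      apply Real.exp_le_exp.mpr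
      have := Real.pi_pos
      have hy2 : a < y.im := hy
      nlinarith
    simp only [g', u, norm_mul, norm_pow, Complex.norm_I, Complex.norm_real, Complex.norm_natCast,
      Complex.norm_ofNat, Real.norm_of_nonneg Real.pi_pos.le, mul_one, pow_one]
    have e1 : ‖cexp (2 * π * I * y)‖ ^ n ≤ r ^ n := pow_le_pow_left₀ (norm_nonneg _) hy' n
    have e2 : ‖PowerSeries.coeff n c‖ * r ^ n ≤ M * (r / r') ^ n := by
      have : r ^ n = r' ^ n * (r / r') ^ n := by
        rw [← mul_pow, mul_div_cancel₀ _ hr'pos.ne']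
      rw [this, ← mul_assoc]
      exact mul_le_mul_of_nonneg_right (hM n) (by positivity)
    have e3 : ‖PowerSeries.coeff n c‖ * ‖cexp (2 * π * I * y)‖ ^ n ≤ M * (r / r') ^ n :=
      le_trans (mul_le_mul_of_nonneg_left e1 (norm_nonneg _)) e2
    calc 2 * π * (↑n * ‖PowerSeries.coeff n c‖ * ‖cexp (2 * π * I * y)‖ ^ n)
        = 2 * π * n * (‖PowerSeries.coeff n c‖ * ‖cexp (2 * π * I * y)‖ ^ n) := by ring
      _ ≤ 2 * π * n * (M * (r / r') ^ n) := by
          apply mul_le_mul_of_nonneg_left e3; positivity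
      _ = _ := by ring
  have hzt : (z : ℂ) ∈ t := by
    change a < z.im
    rw [ha]; linarith
  have key := hasDerivAt_tsum_of_isPreconnected hu hto htc hg hg' hzt (hF z).summable hzt
  have hsum' : Summable fun n => g' n z := Summable.of_norm_bounded hu fun n => hg' n z hzt
  have hev : (F ∘ ofComplex) =ᶠ[nhds (z:ℂ)] fun w => ∑' n, g n w := by
    filter_upwards [hto.mem_nhds hzt] with w hw
    have hw0 : 0 < w.im := lt_trans (by positivity) (show a < w.im from hw)
    have := (hF ⟨w, hw0⟩).tsum_eq
    rw [Function.comp_apply, ofComplex_apply_of_im_pos hw0]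
    exact this.symm
  have hd : _root_.deriv (F ∘ ofComplex) z = ∑' n, g' n z := by
    rw [hev.deriv_eq]; exact key.deriv
  have hpi : (2 * π * I : ℂ) ≠ 0 := Complex.two_pi_I_ne_zero
  have := (hsum'.hasSum.mul_left (2 * π * I)⁻¹)
  rw [← hd] at this
  have hfe : (fun n => (2 * π * I : ℂ)⁻¹ * g' n z) = fun m : ℕ =>
      PowerSeries.coeff m (PowerSeries.mk fun m => m * PowerSeries.coeff m c)
        * cexp (2 * π * I * z) ^ m := by
    funext m
    simp only [g', PowerSeries.coeff_mk]
    field_simp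
  rw [hfe] at this
  exact this

/-- A holomorphic `SL₂(ℤ)`-invariant function of weight `< 12` with a `q`-expansion with vanishing
constant coefficient has vanishing `q`-expansion. -/
lemma ram_aux {k : ℤ} (hk : k < 12) {W : ℍ → ℂ} (hW : MDiff W)
    (hs : ∀ γ : SL(2, ℤ), W ∣[k] γ = W) {c : PowerSeries ℂ} (hc : HasQ c W)
    (h0 : PowerSeries.coeff 0 c = 0) : c = 0 := by
  have hc' : ∀ τ : ℍ, HasSum (fun m => PowerSeries.coeff m c • Function.Periodic.qParam 1 τ ^ m)
      (W τ) := fun τ => by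
    simpa [Function.Periodic.qParam] using hc τ
  let f : ModularForm 𝒮ℒ k :=
    { toFun := W
      slash_action_eq' := fun _ ⟨γ, hγ⟩ ↦ hγ ▸ hs γ
      holo' := hW
      bdd_at_cusps' := by
        intro c hc
        rw [Subgroup.IsArithmetic.isCusp_iff_isCusp_SL2Z] at hc
        rw [OnePoint.isBoundedAt_iff_forall_SL2Z hc]
        intro γ _
        rw [hs γ]
        exact isBoundedAtImInfty_of_hasSum_qExpansion one_pos hc' }
  have hcoef : ∀ m, PowerSeries.coeff m c = (qExpansion 1 f).coeff m := fun m =>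
    ModularFormClass.qExpansion_coeff_unique (f := f) one_pos one_mem_strictPeriods_SL hc' m
  have hq : c = qExpansion 1 f := by ext m; exact hcoef m
  have hf : f = 0 := by
    apply sturm_bound_levelOne
    have : k.toNat / 12 = 0 := by omega
    rw [this, ← hq]
    simp only [Nat.cast_zero]
    rw [pos_iff_ne_zero]
    rw [PowerSeries.order_ne_zero_iff_constCoeff_eq_zero]
    simpa using h0
  rw [hq, hf]
  simpa using UpperHalfPlane.qExpansion_zero 1

lemma E2_slash' (γ : SL(2, ℤ)) : EisensteinSeries.E2 ∣[(2 : ℤ)] γ =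
    fun z => EisensteinSeries.E2 z + 12 * (2 * π * I)⁻¹ * (γ 1 0 * denom γ z ^ (-1 : ℤ)) := by
  rw [EisensteinSeries.E2_slash_action]
  ext z
  simp only [Pi.sub_apply, Pi.smul_apply, EisensteinSeries.D2, riemannZeta_two, smul_eq_mul]
  have hpi : (π : ℂ) ≠ 0 := by exact_mod_cast Real.pi_ne_zero
  have := denom_ne_zero γ z
  rw [zpow_neg_one]
  field_simp
  ring_nf
  simp

lemma D_E2_slash (γ : SL(2, ℤ)) : serreDerivative 1 EisensteinSeries.E2 ∣[(4 : ℤ)] γ =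
    serreDerivative 1 EisensteinSeries.E2 := by
  ext z
  have hd := denom_ne_zero γ z
  have h1 := congrFun (normalizedDerivOfComplex_SL_slash (k := 2) E2_mdifferentiable (γ := γ)) z
  have h2 : normalizedDerivOfComplex (EisensteinSeries.E2 ∣[(2 : ℤ)] γ) z =
      normalizedDerivOfComplex EisensteinSeries.E2 z -
        12 * ((2 * π * I)⁻¹) ^ 2 * (γ 1 0) ^ 2 * (denom γ z ^ (-2 : ℤ)) := by
    rw [E2_slash']
    have e1 : HasDerivAt (EisensteinSeries.E2 ∘ ofComplex)
        (_root_.deriv (EisensteinSeries.E2 ∘ ofComplex) z) (z : ℂ) :=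
      (UpperHalfPlane.mdifferentiableAt_iff.mp (E2_mdifferentiable z)).hasDerivAt
    have e2 := (hasDerivAt_denom_zpow (γ : GL (Fin 2) ℝ) (-1) z)
    have e3 := e1.add ((e2.const_mul (γ 1 0 : ℂ)).const_mul (12 * (2 * π * I)⁻¹))
    have hev : ((fun z : ℍ => EisensteinSeries.E2 z +
        12 * (2 * π * I)⁻¹ * (γ 1 0 * denom γ z ^ (-1 : ℤ))) ∘ ofComplex) =ᶠ[nhds (z : ℂ)]
        ((EisensteinSeries.E2 ∘ ofComplex) +
          fun w : ℂ => 12 * (2 * π * I)⁻¹ * (γ 1 0 * denom γ w ^ (-1 : ℤ))) := by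
      filter_upwards [isOpen_upperHalfPlaneSet.mem_nhds z.im_pos] with w hw
      simp [ofComplex_apply_of_im_pos hw]
    simp only [normalizedDerivOfComplex]
    rw [hev.deriv_eq, e3.deriv]
    simp
    ring
  have h3 := congrFun (E2_slash' γ) z
  rw [h2] at h1
  simp only [Pi.sub_apply] at h1
  rw [h3] at h1
  have h4 : (normalizedDerivOfComplex EisensteinSeries.E2 ∣[(4 : ℤ)] γ) z =
    normalizedDerivOfComplex EisensteinSeries.E2 z -
        12 * ((2 * π * I)⁻¹) ^ 2 * (γ 1 0) ^ 2 * (denom γ z ^ (-2 : ℤ)) +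
      2 * (2 * π * I)⁻¹ * (γ 1 0 / denom γ z) * (EisensteinSeries.E2 z +
        12 * (2 * π * I)⁻¹ * (γ 1 0 * denom γ z ^ (-1 : ℤ))) := by
    have : (2 : ℤ) + 2 = 4 := by norm_num
    rw [this] at h1
    push_cast at h1
    linear_combination -h1
  rw [SL_slash_apply] at h4 h3 ⊢
  simp only [serreDerivative_apply]
  have h5 : denom γ z ^ (-4 : ℤ) = denom γ z ^ (-2 : ℤ) * denom γ z ^ (-2 : ℤ) := by
    rw [← zpow_add₀ hd]; norm_num
  have h6 : denom γ z ^ (-2 : ℤ) = (denom γ z)⁻¹ ^ 2 := by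
    rw [zpow_neg, inv_pow]; norm_cast
  have h7 : denom γ z ^ (-1 : ℤ) = (denom γ z)⁻¹ := zpow_neg_one _
  have h3' : EisensteinSeries.E2 (γ • z) ^ 2 * denom γ z ^ (-4 : ℤ) =
    (EisensteinSeries.E2 z + 12 * (2 * π * I)⁻¹ * (γ 1 0 * denom γ z ^ (-1 : ℤ))) ^ 2 := by
    rw [← h3, h5]; ring
  rw [h7, h6, div_eq_mul_inv] at h4
  rw [h7] at h3'
  linear_combination h4 - (1/12) * h3'

end Ramanujan


section Ramanujan2
open UpperHalfPlane hiding I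
open Complex ModularForm EisensteinSeries Derivative Filter
open scoped MatrixGroups Manifold Real

lemma sigmaQ_eq (j n : ℕ) : sigmaQ j n = ((ArithmeticFunction.sigma j n : ℕ) : ℚ) := by
  simp [sigmaQ, ArithmeticFunction.sigma_apply]

/-- The series over `ℂ`. -/
def toC (c : PowerSeries ℚ) : PowerSeries ℂ := PowerSeries.map (algebraMap ℚ ℂ) c

lemma hasQ_E2 : HasQ (toC E2s) EisensteinSeries.E2 := by
  intro z
  have := hasSum_qExpansion_E2 (z := z)
  convert! this using 2 with m
  simp [toC, E2s, sigmaQ_eq]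
  split_ifs <;> simp

lemma hasQ_E {k : ℕ} (hk : 3 ≤ k) (hk2 : Even k) (c : PowerSeries ℚ)
    (h : ∀ m, PowerSeries.coeff m c = if m = 0 then 1 else
      -(2 * k / (bernoulli k)) * sigmaQ (k - 1) m) : HasQ (toC c) (ModularForm.E hk) := by
  intro z
  have := ModularForm.hasSum_qExpansion (f := ModularForm.E hk) one_pos one_mem_strictPeriods_SL z
  convert! this using 2 with m
  rw [E_qExpansion_coeff hk hk2]
  simp only [toC, PowerSeries.coeff_map, h, sigmaQ_eq, Function.Periodic.qParam]
  split_ifs <;> simp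

lemma hasQ_E4 : HasQ (toC E4s) E₄ := by
  apply hasQ_E _ (by decide)
  intro m
  have : bernoulli 4 = -1/30 := by decide +kernel
  simp only [E4s, PowerSeries.coeff_mk, this]
  norm_num

lemma hasQ_E6 : HasQ (toC E6s) E₆ := by
  apply hasQ_E _ (by decide)
  intro m
  have : bernoulli 6 = 1/42 := by decide +kernel
  simp only [E6s, PowerSeries.coeff_mk, this]
  norm_num

/-- `q d/dq` -/
def thetaS (c : PowerSeries ℚ) : PowerSeries ℚ :=
  PowerSeries.mk fun m => m * PowerSeries.coeff m c

lemma HasQ.deriv' {c : PowerSeries ℚ} {F : ℍ → ℂ} (hF : HasQ (toC c) F) :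
    HasQ (toC (thetaS c)) (normalizedDerivOfComplex F) := by
  have := hF.deriv
  convert! this using 1
  ext m
  simp [toC, thetaS]

lemma toC_inj {c : PowerSeries ℚ} (h : toC c = 0) : c = 0 := by
  ext m
  have := congrArg (PowerSeries.coeff m) h
  simpa [toC] using this

lemma HasQ.serre {c : PowerSeries ℚ} {F : ℍ → ℂ} (hF : HasQ (toC c) F) (a : ℚ) (b : ℂ) (hb : b = a) :
    HasQ (toC (thetaS c - PowerSeries.C (a / 12) * E2s * c)) (serreDerivative b F) := by
  have h := (hF.deriv').add ((hasQ_E2.mul hF).smul (-a/12))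
  convert! h using 1
  · simp [toC, map_sub, map_mul, PowerSeries.map_C, neg_div, mul_assoc, sub_eq_add_neg]
  · ext z
    simp [serreDerivative_apply, hb]
    ring

lemma E_slash {k : ℕ} (hk : 3 ≤ k) (γ : SL(2, ℤ)) : (ModularForm.E hk : ℍ → ℂ) ∣[(k : ℤ)] γ = ModularForm.E hk :=
  SlashInvariantForm.slash_action_eqn (ModularForm.E hk) _ ⟨γ, rfl⟩

lemma cc_toC (c : PowerSeries ℚ) :
    PowerSeries.constantCoeff (toC c) = ((PowerSeries.constantCoeff c : ℚ) : ℂ) := by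
  rw [← PowerSeries.coeff_zero_eq_constantCoeff, ← PowerSeries.coeff_zero_eq_constantCoeff]
  simp [toC]

lemma cc_E2s : PowerSeries.constantCoeff E2s = 1 := by
  rw [← PowerSeries.coeff_zero_eq_constantCoeff]; simp [E2s]

lemma cc_E4s : PowerSeries.constantCoeff E4s = 1 := by
  rw [← PowerSeries.coeff_zero_eq_constantCoeff]; simp [E4s]

lemma cc_E6s : PowerSeries.constantCoeff E6s = 1 := by
  rw [← PowerSeries.coeff_zero_eq_constantCoeff]; simp [E6s]

lemma cc_thetaS (c : PowerSeries ℚ) : PowerSeries.constantCoeff (thetaS c) = 0 := by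
  rw [← PowerSeries.coeff_zero_eq_constantCoeff]; simp [thetaS]

lemma ram2 : thetaS E2s = PowerSeries.C (1/12) * (E2s ^ 2 - E4s) := by
  have h := (hasQ_E2.serre 1 1 (by simp)).add (hasQ_E4.smul (1/12))
  have h2 := ram_aux (k := 4) (by norm_num) ?_ ?_ h ?_
  · have : toC (thetaS E2s - PowerSeries.C (1 / 12) * E2s * E2s + PowerSeries.C (1/12) * E4s) = 0 := by
      rw [← h2]
      simp [toC]
    have := toC_inj this
    linear_combination this
  · exact (serreDerivative_mdifferentiable _ E2_mdifferentiable).add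
      (mdifferentiable_const.mul (ModularFormClass.holo E₄))
  · intro γ
    change (serreDerivative 1 EisensteinSeries.E2 + (1/12 : ℂ) • (E₄ : ℍ → ℂ)) ∣[(4 : ℤ)] γ = serreDerivative 1 EisensteinSeries.E2 + (1/12 : ℂ) • (E₄ : ℍ → ℂ)
    rw [SlashAction.add_slash, D_E2_slash, SL_smul_slash]
    congr 2
    exact E_slash _ γ
  · simp [PowerSeries.coeff_zero_eq_constantCoeff, cc_toC, cc_E2s, cc_E4s, cc_E6s, cc_thetaS]

lemma ram4 : thetaS E4s = PowerSeries.C (1/3) * (E2s * E4s - E6s) := by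
  have h := (hasQ_E4.serre 4 (4:ℤ) (by simp)).add (hasQ_E6.smul (1/3))
  have h2 := ram_aux (k := 6) (by norm_num) ?_ ?_ h ?_
  · have : toC (thetaS E4s - PowerSeries.C (4 / 12) * E2s * E4s + PowerSeries.C (1/3) * E6s) = 0 := by
      rw [← h2]
      simp [toC]
    have := toC_inj this
    rw [show (4/12 : ℚ) = 1/3 by norm_num] at this
    linear_combination this
  · exact (serreDerivative_mdifferentiable _ (ModularFormClass.holo E₄)).add
      (mdifferentiable_const.mul (ModularFormClass.holo E₆))
  · intro γ
    change (serreDerivative (4:ℤ) E₄ + (1/3 : ℂ) • (E₆ : ℍ → ℂ)) ∣[(6 : ℤ)] γ = serreDerivative (4:ℤ) E₄ + (1/3 : ℂ) • (E₆ : ℍ → ℂ)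
    rw [SlashAction.add_slash, SL_smul_slash]
    congr 1
    · exact serreDerivative_slash_invariant (ModularFormClass.holo E₄) (E_slash _ γ)
    · congr 1
      exact E_slash _ γ
  · simp [PowerSeries.coeff_zero_eq_constantCoeff, cc_toC, cc_E2s, cc_E4s, cc_E6s, cc_thetaS]
    norm_num

lemma ram6 : thetaS E6s = PowerSeries.C (1/2) * (E2s * E6s - E4s ^ 2) := by
  have h := (hasQ_E6.serre 6 (6:ℤ) (by simp)).add ((hasQ_E4.mul hasQ_E4).smul (1/2))
  have h2 := ram_aux (k := 8) (by norm_num) ?_ ?_ h ?_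
  · have : toC (thetaS E6s - PowerSeries.C (6 / 12) * E2s * E6s + PowerSeries.C (1/2) * (E4s * E4s)) = 0 := by
      rw [← h2]
      simp [toC]
    have := toC_inj this
    rw [show (6/12 : ℚ) = 1/2 by norm_num] at this
    linear_combination this
  · exact (serreDerivative_mdifferentiable _ (ModularFormClass.holo E₆)).add
      (mdifferentiable_const.mul ((ModularFormClass.holo E₄).mul (ModularFormClass.holo E₄)))
  · intro γ
    change (serreDerivative (6:ℤ) E₆ + (1/2 : ℂ) • ((E₄ : ℍ → ℂ) * E₄)) ∣[(8 : ℤ)] γ = serreDerivative (6:ℤ) E₆ + (1/2 : ℂ) • ((E₄ : ℍ → ℂ) * E₄)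
    rw [SlashAction.add_slash, SL_smul_slash]
    congr 1
    · exact serreDerivative_slash_invariant (ModularFormClass.holo E₆) (E_slash _ γ)
    · congr 1
      have := mul_slash_SL2 4 4 γ (E₄ : ℍ → ℂ) E₄
      rw [show (8:ℤ) = 4 + 4 by norm_num, this]
      congr 1 <;> exact E_slash _ γ
  · simp [PowerSeries.coeff_zero_eq_constantCoeff, cc_toC, cc_E2s, cc_E4s, cc_E6s, cc_thetaS]
    norm_num

end Ramanujan2

/-- `thetaS` satisfies the Leibniz rule. -/
lemma thetaS_mul (a b : PowerSeries ℚ) : thetaS (a * b) = thetaS a * b + a * thetaS b := by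
  ext m
  simp only [thetaS, PowerSeries.coeff_mk, map_add, PowerSeries.coeff_mul, Finset.mul_sum]
  rw [← Finset.sum_add_distrib]
  refine Finset.sum_congr rfl fun x hx => ?_
  rw [← Finset.HasAntidiagonal.mem_antidiagonal.mp hx]
  push_cast; ring

lemma thetaS_add (a b : PowerSeries ℚ) : thetaS (a + b) = thetaS a + thetaS b := by
  ext m
  simp only [thetaS, PowerSeries.coeff_mk, map_add]; ring

lemma thetaS_C (a : ℚ) : thetaS (PowerSeries.C a) = 0 := by
  ext m
  simp only [thetaS, PowerSeries.coeff_mk, PowerSeries.coeff_C, map_zero]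
  split_ifs with h <;> simp [h]

lemma Dop_add (f g : Poly3) : Dop (f + g) = Dop f + Dop g := by
  simp only [Dop, map_add]; ring

lemma Dop_mul (f g : Poly3) : Dop (f * g) = Dop f * g + f * Dop g := by
  simp only [Dop, Derivation.leibniz, smul_eq_mul]; ring

lemma Dop_C (a : ℚ) : Dop (C a) = 0 := by
  simp [Dop]

lemma Dop_X0 : Dop (X 0) = C (1/12) * (X 0 ^ 2 - X 1) := by
  simp [Dop, pderiv_X, Pi.single_apply]

lemma Dop_X1 : Dop (X 1) = C (1/3) * (X 0 * X 1 - X 2) := by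
  simp [Dop, pderiv_X, Pi.single_apply]

lemma Dop_X2 : Dop (X 2) = C (1/2) * (X 0 * X 2 - X 1 ^ 2) := by
  simp [Dop, pderiv_X, Pi.single_apply]

lemma Phi_C (a : ℚ) : Phi (C a) = PowerSeries.C a := by
  simp [Phi]

lemma Phi_X0 : Phi (X 0) = E2s := by simp [Phi]
lemma Phi_X1 : Phi (X 1) = E4s := by simp [Phi]
lemma Phi_X2 : Phi (X 2) = E6s := by simp [Phi]

/-- Ramanujan's identities. -/
lemma Phi_Dop (f : Poly3) : Phi (Dop f) = thetaS (Phi f) := by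
  induction f using MvPolynomial.induction_on with
  | C a => rw [Dop_C, Phi_C, thetaS_C, map_zero]
  | add f g hf hg => rw [Dop_add, map_add, map_add, thetaS_add, hf, hg]
  | mul_X f i hf =>
    rw [Dop_mul, map_add, map_mul, map_mul, map_mul, thetaS_mul, hf]
    congr 2
    fin_cases i
    · change Phi (Dop (X 0)) = thetaS (Phi (X 0))
      rw [Dop_X0, Phi_X0, ram2]; simp [Phi_C, Phi_X0, Phi_X1]
    · change Phi (Dop (X 1)) = thetaS (Phi (X 1))
      rw [Dop_X1, Phi_X1, ram4]; simp [Phi_C, Phi_X0, Phi_X1, Phi_X2]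
    · change Phi (Dop (X 2)) = thetaS (Phi (X 2))
      rw [Dop_X2, Phi_X2, ram6]; simp [Phi_C, Phi_X0, Phi_X1, Phi_X2]


section CK

/-- shift of a sequence, with value `0` at `0`. -/
def shiftSeq (u : ℕ → Poly3) : ℕ → Poly3
  | 0 => 0
  | n + 1 => u n

lemma Dop_sum {ι : Type*} (s : Finset ι) (f : ι → Poly3) : Dop (∑ i ∈ s, f i) = ∑ i ∈ s, Dop (f i) := by
  classical
  induction s using Finset.induction_on with
  | empty => simp [Dop]
  | insert a s ha ih => rw [Finset.sum_insert ha, Finset.sum_insert ha, Dop_add, ih]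

lemma CK_abs (u g : ℕ → Poly3) (k : ℕ) (P' Q' : Poly3)
    (hu : ∀ j, Dop (u j) = (j : Poly3) * (j + 1) * u (j + 1) - Q' * shiftSeq u j)
    (hg : ∀ r, Dop (g r) = (k + 2 * r) * (P' * g r) + (r + 1) * (k + r) * g (r + 1)
      + Q' * shiftSeq g r)
    (hP : ∀ j, P' * u j = (j + 1) * u (j + 1)) (n : ℕ) :
    Dop (∑ x ∈ antidiagonal n, u x.1 * g x.2) =
      (n + 1) * (n + k) * ∑ x ∈ antidiagonal (n + 1), u x.1 * g x.2 := by
  rw [Dop_sum]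
  have h1 : ∀ x ∈ antidiagonal n, Dop (u x.1 * g x.2) =
      ((x.1 + 1 : ℕ) : Poly3) * (((x.1 + 1 : ℕ) : Poly3) - 1 + k + 2 * x.2) * (u (x.1 + 1) * g x.2)
      + ((x.2 + 1 : ℕ) : Poly3) * (((x.2 + 1 : ℕ) : Poly3) - 1 + k) * (u x.1 * g (x.2 + 1))
      + (Q' * (u x.1 * shiftSeq g x.2) - Q' * (shiftSeq u x.1 * g x.2)) := by
    intro x _
    rw [Dop_mul, hu, hg]
    push_cast
    linear_combination ((k : Poly3) + 2 * x.2) * g x.2 * hP x.1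
  rw [Finset.sum_congr rfl h1, Finset.sum_add_distrib, Finset.sum_add_distrib]
  have e1 := Finset.Nat.sum_antidiagonal_succ (n := n) (f := fun x : ℕ × ℕ =>
    (x.1 : Poly3) * ((x.1 : Poly3) - 1 + k + 2 * x.2) * (u x.1 * g x.2))
  have e2 := Finset.Nat.sum_antidiagonal_succ' (n := n) (f := fun x : ℕ × ℕ =>
    (x.2 : Poly3) * ((x.2 : Poly3) - 1 + k) * (u x.1 * g x.2))
  have e3 : ∑ x ∈ antidiagonal n, (Q' * (u x.1 * shiftSeq g x.2) - Q' * (shiftSeq u x.1 * g x.2))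
      = 0 := by
    cases n with
    | zero => simp [shiftSeq]
    | succ m =>
      rw [Finset.sum_sub_distrib]
      rw [Finset.Nat.sum_antidiagonal_succ', Finset.Nat.sum_antidiagonal_succ]
      simp [shiftSeq]
  simp only [Nat.cast_zero, zero_mul, zero_add, add_zero] at e1 e2
  rw [← e1, ← e2, e3, add_zero, ← Finset.sum_add_distrib, Finset.mul_sum]
  refine Finset.sum_congr rfl fun x hx => ?_
  have hx' := Finset.HasAntidiagonal.mem_antidiagonal.mp hx
  have : (x.1 : Poly3) + x.2 = n + 1 := by exact_mod_cast hx'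
  linear_combination ((x.1 : Poly3) + x.2 + n + k) * (u x.1 * g x.2) * this

/-- weights: `P` has weight `(1, 2)`, `Q` has weight `(0, 4)`, `R` has weight `(0, 6)`. -/
def wtf : Fin 3 → ℤ × ℤ := ![(1, 2), (0, 4), (0, 6)]

/-- modular polynomial of weight `w`: isobaric and not involving `P`. -/
def Mf (w : ℤ) (f : Poly3) : Prop := IsWeightedHomogeneous wtf f (0, w)

lemma Mf_iff (w : ℕ) (f : Poly3) : Mf w f ↔ Isobaric w f ∧ NoP f := by
  have hw : ∀ d : Fin 3 →₀ ℕ, Finsupp.weight wtf d = ((d 0 : ℤ), 2 * (d 0 : ℤ) + 4 * d 1 + 6 * d 2) := by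
    intro d
    rw [Finsupp.weight_apply, Finsupp.sum_fintype _ _ (by simp)]
    rw [Fin.sum_univ_three]
    ext
    · simp [wtf]
    · simp [wtf]; ring
  simp only [Mf, IsWeightedHomogeneous, hw, Prod.mk.injEq, Isobaric, NoP, mem_support_iff]
  constructor
  · intro h
    exact ⟨fun m hm => by have := h hm; omega, fun m hm => by have := h hm; omega⟩
  · intro ⟨h1, h2⟩ d hd
    have := h1 d hd
    have := h2 d hd
    omega

lemma Mf.add {w : ℤ} {f g : Poly3} (hf : Mf w f) (hg : Mf w g) : Mf w (f + g) :=
  IsWeightedHomogeneous.add hf hg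

lemma Mf.mul {w v : ℤ} {f g : Poly3} (hf : Mf w f) (hg : Mf v g) : Mf (w + v) (f * g) := by
  have := IsWeightedHomogeneous.mul hf hg
  simpa [Mf] using this

lemma Mf_C (a : ℚ) : Mf 0 (C a) := isWeightedHomogeneous_C _ _

lemma Mf.smul {w : ℤ} {f : Poly3} (a : ℚ) (hf : Mf w f) : Mf w (C a * f) := by
  simpa using (Mf_C a).mul hf

lemma Mf.neg {w : ℤ} {f : Poly3} (hf : Mf w f) : Mf w (- f) := by
  simpa using hf.smul (-1)

lemma Mf.sub {w : ℤ} {f g : Poly3} (hf : Mf w f) (hg : Mf w g) : Mf w (f - g) := by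
  rw [sub_eq_add_neg]; exact hf.add hg.neg

lemma Mf.pow {w : ℤ} {f : Poly3} (hf : Mf w f) (n : ℕ) : Mf (n * w) (f ^ n) := by
  induction n with
  | zero => simpa using Mf_C 1
  | succ n ih =>
    rw [pow_succ]
    have := ih.mul hf
    convert! this using 1
    push_cast; ring

lemma Mf_X1 : Mf 4 (X 1) := isWeightedHomogeneous_X _ _ _
lemma Mf_X2 : Mf 6 (X 2) := isWeightedHomogeneous_X _ _ _

lemma Mf.sum {ι : Type*} {w : ℤ} (s : Finset ι) {f : ι → Poly3} (hf : ∀ i ∈ s, Mf w (f i)) :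
    Mf w (∑ i ∈ s, f i) := by
  exact IsWeightedHomogeneous.sum s _ _ hf

/-- The (Serre) derivation `f ↦ D f - (w/12) P f` on forms of weight `w`. -/
def dS (f : Poly3) : Poly3 :=
  -(C (1/3 : ℚ) * X 2 * pderiv 1 f) - C (1/2 : ℚ) * X 1 ^ 2 * pderiv 2 f

lemma Mf.dS {w : ℤ} {f : Poly3} (hf : Mf w f) : Mf (w + 2) (dS f) := by
  have h1 : Mf (w - 4) (pderiv 1 f) := IsWeightedHomogeneous.pderiv hf (by simp [wtf])
  have h2 : Mf (w - 6) (pderiv 2 f) := IsWeightedHomogeneous.pderiv hf (by simp [wtf])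
  refine Mf.sub (Mf.neg ?_) ?_
  · have := (Mf_X2.mul h1).smul (1/3)
    convert! this using 1
    · ring
    · ring
  · have := ((Mf_X1.pow 2).mul h2).smul (1/2)
    convert! this using 1
    · push_cast; ring
    · ring

lemma Dop_eq_dS {w : ℕ} {f : Poly3} (hf : Mf w f) : Dop f = dS f + C (w / 12 : ℚ) * X 0 * f := by
  obtain ⟨h1, h2⟩ := (Mf_iff w f).mp hf
  have hE : ∀ m ∈ f.support, 2 * m 0 + 4 * m 1 + 6 * m 2 = w ∧ m 0 = 0 := fun m hm => ⟨h1 m hm, h2 m hm⟩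
  have hp0 : pderiv 0 f = 0 := by
    rw [f.as_sum, map_sum]
    refine Finset.sum_eq_zero fun m hm => ?_
    rw [pderiv_monomial, (hE m hm).2]; simp
  have hEu : C 4 * (X 1 * pderiv 1 f) + C 6 * (X 2 * pderiv 2 f) = C (w : ℚ) * f := by
    conv_lhs => rw [f.as_sum]
    conv_rhs => rw [f.as_sum]
    simp only [map_sum, Finset.mul_sum]
    rw [← Finset.sum_add_distrib]
    refine Finset.sum_congr rfl fun m hm => ?_
    rw [X_mul_pderiv_monomial, X_mul_pderiv_monomial]
    have := hE m hm
    have h3 : (4 * m 1 + 6 * m 2 : ℚ) = w := by exact_mod_cast (by omega : 4 * m 1 + 6 * m 2 = w)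
    rw [← h3, nsmul_eq_mul, nsmul_eq_mul]
    simp only [map_add, map_mul, map_natCast]
    ring
  simp only [Dop, dS, hp0]
  have c1 : (C (w / 12 : ℚ) : Poly3) = C (1/12) * C (w:ℚ) := by rw [← C_mul]; congr 1; ring
  have c2 : (C (1/3 : ℚ) : Poly3) = C (1/12) * C 4 := by rw [← C_mul]; congr 1; norm_num
  have c3 : (C (1/2 : ℚ) : Poly3) = C (1/12) * C 6 := by rw [← C_mul]; congr 1; norm_num
  rw [c1, c2, c3]
  linear_combination C (1/12) * X 0 * hEu

/-- The Cohen-Kuznetsov sequence of a form of weight `k`. -/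
def Fseq (k : ℕ) (F : Poly3) : ℕ → Poly3
  | 0 => F
  | 1 => dS F
  | r + 2 => dS (Fseq k F (r + 1)) - C ((r + 1) * (r + k) / 144 : ℚ) * X 1 * Fseq k F r

lemma Fseq_Mf {k : ℕ} {F : Poly3} (hF : Mf k F) : ∀ r : ℕ, Mf ((k + 2 * r : ℕ) : ℤ) (Fseq k F r)
  | 0 => by simpa [Fseq] using hF
  | 1 => by simpa [Fseq] using hF.dS
  | r + 2 => by
    rw [Fseq]
    refine Mf.sub ?_ ?_
    · have := (Fseq_Mf hF (r + 1)).dS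
      convert! this using 1
    · have := (Mf_X1.mul (Fseq_Mf hF r)).smul ((r + 1) * (r + k) / 144 : ℚ)
      convert! this using 1
      · push_cast; ring
      · ring

lemma dS_smul (a : ℚ) (f : Poly3) : dS (C a * f) = C a * dS f := by
  simp only [dS, Derivation.leibniz, pderiv_C, smul_eq_mul]; ring

lemma natCast_eq_C (n : ℕ) : (n : Poly3) = C (n : ℚ) := by simp

/-- `P / 12` -/
def Pd : Poly3 := C (1/12 : ℚ) * X 0

/-- `Q / 144` -/
def Qd : Poly3 := C (1/144 : ℚ) * X 1

open Nat in
/-- Cohen-Kuznetsov expansion of the iterated derivatives. -/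
lemma CK_formula {k : ℕ} (hk : 0 < k) {F : Poly3} (hF : Mf k F) (n : ℕ) :
    Dop^[n] F = ∑ x ∈ antidiagonal n,
      C ((n.choose x.1 * (k + n - 1).descFactorial x.1 : ℕ) : ℚ) *
        Pd ^ x.1 * Fseq k F x.2 := by
  obtain ⟨κ, rfl⟩ : ∃ κ, k = κ + 1 := ⟨k - 1, by omega⟩
  let u : ℕ → Poly3 := fun j => C (1 / (j ! : ℚ)) * Pd ^ j
  let g : ℕ → Poly3 := fun r => C (1 / ((r ! : ℚ) * ((κ + r)! : ℚ))) * Fseq (κ + 1) F r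
  have hP : ∀ j, Pd * u j = ((j : Poly3) + 1) * u (j + 1) := by
    intro j
    have : ((j : Poly3) + 1) = C ((j : ℚ) + 1) := by simp
    simp only [u]
    rw [this, ← mul_assoc (C _) (C _), ← C_mul, Nat.factorial_succ, pow_succ]
    have h0 : (j ! : ℚ) ≠ 0 := by exact_mod_cast Nat.factorial_ne_zero j
    have : ((j : ℚ) + 1) * (1 / ((j + 1) * j ! : ℕ)) = 1 / (j ! : ℚ) := by
      push_cast; field_simp
    rw [this]; ring
  have hDP : Dop Pd = Pd ^ 2 - Qd := by
    unfold Pd Qd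
    rw [Dop_mul, Dop_C, Dop_X0, show (1/144 : ℚ) = 1/12 * (1/12) by norm_num, C_mul]; ring
  have hDpow : ∀ j : ℕ, Dop (Pd ^ (j + 1)) =
      ((j : Poly3) + 1) * Pd ^ j * (Pd ^ 2 - Qd) := by
    intro j
    induction j with
    | zero => simp [hDP]
    | succ j ih => rw [pow_succ, Dop_mul, ih, hDP]; push_cast; ring
  have hu : ∀ j, Dop (u j) = (j : Poly3) * (j + 1) * u (j + 1) - Qd * shiftSeq u j := by
    intro j
    rw [mul_assoc, ← hP]
    cases j with
    | zero => simp [u, shiftSeq, Dop]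
    | succ j =>
      have h2 : u j = ((j : Poly3) + 1) * C (1 / ((j + 1)! : ℚ)) * Pd ^ j := by
        have : ((j : Poly3) + 1) = C ((j : ℚ) + 1) := by simp
        simp only [u]
        rw [this, ← C_mul, Nat.factorial_succ]
        have h0 : (j ! : ℚ) ≠ 0 := by exact_mod_cast Nat.factorial_ne_zero j
        congr 2
        push_cast; field_simp
      simp only [shiftSeq, h2]
      simp only [u]
      rw [Dop_mul, Dop_C, hDpow]
      push_cast
      ring
  have hg : ∀ r, Dop (g r) = (((κ + 1 : ℕ) : Poly3) + 2 * (r : Poly3)) * (Pd * g r) +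
      ((r : Poly3) + 1) * (((κ + 1 : ℕ) : Poly3) + (r : Poly3)) * g (r + 1) + Qd * shiftSeq g r := by
    intro r
    have hr := (Fseq_Mf hF r).smul (1 / ((r ! : ℚ) * ((κ + r)! : ℚ)))
    change Dop (C (1 / ((r ! : ℚ) * ((κ + r)! : ℚ))) * Fseq (κ + 1) F r) = _
    rw [Dop_eq_dS hr, dS_smul]
    have h0 : (r ! : ℚ) ≠ 0 := by exact_mod_cast Nat.factorial_ne_zero r
    have h1 : ((κ + r) ! : ℚ) ≠ 0 := by exact_mod_cast Nat.factorial_ne_zero _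
    have c1 : (C (((κ + 1 + 2 * r : ℕ) : ℚ) / 12) : Poly3) = (((κ + 1 : ℕ) : Poly3) + 2 * (r : Poly3)) * C (1/12) := by
      rw [div_eq_mul_one_div, C_mul, ← natCast_eq_C]; push_cast; ring
    have c2 : (((r : Poly3) + 1) * (((κ + 1 : ℕ) : Poly3) + (r : Poly3))) * C (1 / (((r + 1) ! : ℚ) * ((κ + (r + 1))! : ℚ)))
        = C (1 / ((r ! : ℚ) * ((κ + r)! : ℚ))) := by
      have : (((r : Poly3) + 1) * (((κ + 1 : ℕ) : Poly3) + (r : Poly3))) = C (((r : ℚ) + 1) * ((κ + 1 : ℕ) + r)) := by simp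
      rw [this, ← C_mul, ← add_assoc, Nat.factorial_succ, Nat.factorial_succ]
      congr 1
      push_cast
      have : ((κ : ℚ) + r + 1) ≠ 0 := by positivity
      have : ((κ : ℚ) + 1 + r) ≠ 0 := by positivity
      field_simp
      ring
    have e : ((r : Poly3) + 1) * (((κ + 1 : ℕ) : Poly3) + (r : Poly3)) * g (r + 1) =
        C (1 / ((r ! : ℚ) * ((κ + r)! : ℚ))) * Fseq (κ + 1) F (r + 1) := by
      simp only [g]
      rw [← mul_assoc, c2]
    rw [e, c1]
    have hPd : Pd = C (1/12) * X 0 := rfl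
    have hQd : Qd = C (1/144) * X 1 := rfl
    cases r with
    | zero => simp only [shiftSeq, Fseq, g, hPd]; push_cast; ring
    | succ r =>
      have c3 : C (1 / (((r + 1) ! : ℚ) * ((κ + (r + 1))! : ℚ))) * C ((r + 1) * (r + (κ + 1 : ℕ)) / 144 : ℚ) =
          (C (1/144) * C (1 / ((r ! : ℚ) * ((κ + r)! : ℚ))) : Poly3) := by
        rw [← C_mul, ← C_mul, ← add_assoc, Nat.factorial_succ, Nat.factorial_succ]
        have h0 : (r ! : ℚ) ≠ 0 := by exact_mod_cast Nat.factorial_ne_zero r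
        have h1 : ((κ + r) ! : ℚ) ≠ 0 := by exact_mod_cast Nat.factorial_ne_zero _
        have : ((κ : ℚ) + r + 1) ≠ 0 := by positivity
        congr 1
        push_cast
        field_simp
        ring
      simp only [shiftSeq, Fseq, g, hPd, hQd]
      push_cast at c3 ⊢
      linear_combination X 1 * Fseq (κ + 1) F r * c3
  have main : ∀ n, Dop^[n] F = C ((n ! : ℚ) * ((κ + n)! : ℚ)) * ∑ x ∈ antidiagonal n, u x.1 * g x.2 := by
    intro n
    induction n with
    | zero =>
      simp only [Function.iterate_zero, id, antidiagonal_zero, sum_singleton, u, g, Fseq]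
      simp only [pow_zero, mul_one, ← mul_assoc, ← C_mul]
      have h1 : (κ ! : ℚ) ≠ 0 := by exact_mod_cast Nat.factorial_ne_zero _
      simp [h1]
    | succ n ih =>
      rw [Function.iterate_succ_apply', ih, Dop_mul, Dop_C, CK_abs u g (κ + 1) _ _ hu hg hP]
      have : ((n : Poly3) + 1) * ((n : Poly3) + ((κ + 1 : ℕ) : Poly3)) = C (((n : ℚ) + 1) * (n + (κ + 1 : ℕ))) := by simp
      rw [this, zero_mul, zero_add, ← mul_assoc, ← C_mul, ← add_assoc, Nat.factorial_succ, Nat.factorial_succ]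
      congr 2
      push_cast; ring
  rw [main n, Finset.mul_sum]
  refine Finset.sum_congr rfl fun x hx => ?_
  have hx' := Finset.HasAntidiagonal.mem_antidiagonal.mp hx
  simp only [u, g]
  have c : ((n ! : ℚ) * ((κ + n)! : ℚ)) * (1 / (x.1 ! : ℚ)) * (1 / ((x.2 ! : ℚ) * ((κ + x.2)! : ℚ))) =
      ((n.choose x.1 * (κ + 1 + n - 1).descFactorial x.1 : ℕ) : ℚ) := by
    have a1 := Nat.choose_mul_factorial_mul_factorial (show x.1 ≤ n by omega)
    have a2 := Nat.factorial_mul_descFactorial (show x.1 ≤ κ + 1 + n - 1 by omega)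
    rw [show n - x.1 = x.2 by omega] at a1
    rw [show κ + 1 + n - 1 - x.1 = κ + x.2 by omega] at a2
    rw [show κ + n = κ + 1 + n - 1 by omega, ← a1, ← a2]
    have h0 : (x.1 ! : ℚ) ≠ 0 := by exact_mod_cast Nat.factorial_ne_zero _
    have h1 : (x.2 ! : ℚ) ≠ 0 := by exact_mod_cast Nat.factorial_ne_zero _
    have h2 : ((κ + x.2) ! : ℚ) ≠ 0 := by exact_mod_cast Nat.factorial_ne_zero _
    push_cast
    field_simp
  rw [← c]
  simp only [C_mul]
  ring

end CK


section Integrality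

variable {p : ℕ}

/-- `ℤ_(p)` as a subring of `ℚ`. -/
def Zp (p : ℕ) (hp : p.Prime) : Subring ℚ where
  carrier := {x | pInt p x}
  mul_mem' {a b} ha hb := fun h => by
    rcases hp.dvd_mul.mp (h.trans (Rat.mul_den_dvd a b)) with h | h
    exacts [ha h, hb h]
  one_mem' := by simpa [pInt] using hp.one_lt.ne'
  add_mem' {a b} ha hb := fun h => by
    rcases hp.dvd_mul.mp (h.trans (Rat.add_den_dvd a b)) with h | h
    exacts [ha h, hb h]
  zero_mem' := by simpa [pInt] using hp.one_lt.ne'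
  neg_mem' {a} ha := by simpa [pInt] using ha

lemma mem_Zp (hp : p.Prime) (x : ℚ) : x ∈ Zp p hp ↔ pInt p x := Iff.rfl

lemma inv_mem_Zp (hp : p.Prime) (n : ℕ) (h : ¬ p ∣ n) : (1 / n : ℚ) ∈ Zp p hp := by
  rw [mem_Zp, pInt]
  intro h2
  apply h
  have : (1 / n : ℚ).den ∣ n := by
    simp only [one_div, Rat.inv_natCast_den]
    split_ifs with h0
    · exact one_dvd _
    · exact dvd_rfl
  exact h2.trans this

/-- `ℤ_(p)[P,Q,R]` as a subring of `ℚ[P,Q,R]`. -/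
def ZpP (p : ℕ) (hp : p.Prime) : Subring Poly3 := (MvPolynomial.map (Zp p hp).subtype).range

lemma mem_ZpP (hp : p.Prime) (f : Poly3) : f ∈ ZpP p hp ↔ polyPInt p f := by
  rw [ZpP, ← SetLike.mem_coe, RingHom.coe_range, MvPolynomial.mem_range_map_iff_coeffs_subset]
  constructor
  · intro h m
    by_cases hm : coeff m f = 0
    · rw [hm]; exact (Zp p hp).zero_mem
    · obtain ⟨y, hy⟩ := h (coeff_mem_coeffs m hm)
      rw [← hy]; exact y.2
  · intro h x hx
    obtain ⟨m, _, rfl⟩ := mem_coeffs_iff.mp hx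
    exact ⟨⟨_, h m⟩, rfl⟩

lemma C_mem (hp : p.Prime) {a : ℚ} (ha : a ∈ Zp p hp) : (C a : Poly3) ∈ ZpP p hp :=
  ⟨C ⟨a, ha⟩, by simp⟩

lemma X_mem (hp : p.Prime) (i : Fin 3) : (X i : Poly3) ∈ ZpP p hp := ⟨X i, by simp⟩

lemma pderiv_mem (hp : p.Prime) {f : Poly3} (hf : f ∈ ZpP p hp) (i : Fin 3) :
    pderiv i f ∈ ZpP p hp := by
  obtain ⟨g, rfl⟩ := hf
  exact ⟨pderiv i g, by rw [← pderiv_map]⟩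

lemma not_dvd_of_prime_lt5 (hp : p.Prime) (hp5 : 5 ≤ p) {n : ℕ} (a b : ℕ) (h : n = 2 ^ a * 3 ^ b) : ¬ p ∣ n := by
  intro hd
  rw [h] at hd
  rcases hp.dvd_mul.mp hd with h | h
  · have := Nat.le_of_dvd (by norm_num) (hp.dvd_of_dvd_pow h); omega
  · have := Nat.le_of_dvd (by norm_num) (hp.dvd_of_dvd_pow h); omega

lemma half_mem (hp : p.Prime) (hp5 : 5 ≤ p) : (1/2 : ℚ) ∈ Zp p hp := by
  exact_mod_cast inv_mem_Zp hp 2 (not_dvd_of_prime_lt5 hp hp5 1 0 (by norm_num))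
lemma third_mem (hp : p.Prime) (hp5 : 5 ≤ p) : (1/3 : ℚ) ∈ Zp p hp := by
  exact_mod_cast inv_mem_Zp hp 3 (not_dvd_of_prime_lt5 hp hp5 0 1 (by norm_num))
lemma twelfth_mem (hp : p.Prime) (hp5 : 5 ≤ p) : (1/12 : ℚ) ∈ Zp p hp := by
  exact_mod_cast inv_mem_Zp hp 12 (not_dvd_of_prime_lt5 hp hp5 2 1 (by norm_num))
lemma inv1728_mem (hp : p.Prime) (hp5 : 5 ≤ p) : (1/1728 : ℚ) ∈ Zp p hp := by
  exact_mod_cast inv_mem_Zp hp 1728 (not_dvd_of_prime_lt5 hp hp5 6 3 (by norm_num))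

lemma dS_mem (hp : p.Prime) (hp5 : 5 ≤ p) {f : Poly3} (hf : f ∈ ZpP p hp) : dS f ∈ ZpP p hp :=
  sub_mem (neg_mem (mul_mem (mul_mem (C_mem hp (third_mem hp hp5)) (X_mem hp 2)) (pderiv_mem hp hf 1)))
    (mul_mem (mul_mem (C_mem hp (half_mem hp hp5)) (pow_mem (X_mem hp 1) 2)) (pderiv_mem hp hf 2))

lemma Fseq_mem (hp : p.Prime) (hp5 : 5 ≤ p) {f : Poly3} (hf : f ∈ ZpP p hp) (k : ℕ) :
    ∀ r, Fseq k f r ∈ ZpP p hp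
  | 0 => hf
  | 1 => dS_mem hp hp5 hf
  | r + 2 => by
    rw [Fseq]
    refine sub_mem (dS_mem hp hp5 (Fseq_mem hp hp5 hf k (r + 1)))
      (mul_mem (mul_mem (C_mem hp ?_) (X_mem hp 1)) (Fseq_mem hp hp5 hf k r))
    have h := twelfth_mem hp hp5
    have : ((r + 1) * (r + k) / 144 : ℚ) = ((r + 1) * (r + k) : ℕ) * (1/12 * (1/12)) := by
      push_cast; ring
    rw [this]
    exact mul_mem (natCast_mem _ _) (mul_mem h h)

/-- `ℤ_(p)[[q]]` as a subring of `ℚ[[q]]`. -/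
def ZpS (p : ℕ) (hp : p.Prime) : Subring (PowerSeries ℚ) := (PowerSeries.map (Zp p hp).subtype).range

lemma mem_ZpS (hp : p.Prime) (f : PowerSeries ℚ) :
    f ∈ ZpS p hp ↔ ∀ n, PowerSeries.coeff n f ∈ Zp p hp := by
  constructor
  · rintro ⟨g, rfl⟩ n
    simp
  · intro h
    refine ⟨PowerSeries.mk fun n => ⟨_, h n⟩, ?_⟩
    ext n; simp

lemma CS_mem (hp : p.Prime) {a : ℚ} (ha : a ∈ Zp p hp) : PowerSeries.C a ∈ ZpS p hp := by
  rw [mem_ZpS]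
  intro n
  rw [PowerSeries.coeff_C]
  split_ifs
  exacts [ha, zero_mem _]

lemma sigmaQ_mem (hp : p.Prime) (j n : ℕ) : sigmaQ j n ∈ Zp p hp :=
  sum_mem fun d _ => pow_mem (natCast_mem _ d) j

lemma E2s_mem (hp : p.Prime) : E2s ∈ ZpS p hp := by
  rw [mem_ZpS]; intro n
  simp only [E2s, PowerSeries.coeff_mk]
  split_ifs
  · exact one_mem _
  · exact mul_mem (by exact_mod_cast intCast_mem (Zp p hp) (-24)) (sigmaQ_mem hp _ _)

lemma E4s_mem (hp : p.Prime) : E4s ∈ ZpS p hp := by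
  rw [mem_ZpS]; intro n
  simp only [E4s, PowerSeries.coeff_mk]
  split_ifs
  · exact one_mem _
  · exact mul_mem (by exact_mod_cast intCast_mem (Zp p hp) (240)) (sigmaQ_mem hp _ _)

lemma E6s_mem (hp : p.Prime) : E6s ∈ ZpS p hp := by
  rw [mem_ZpS]; intro n
  simp only [E6s, PowerSeries.coeff_mk]
  split_ifs
  · exact one_mem _
  · exact mul_mem (by exact_mod_cast intCast_mem (Zp p hp) (-504)) (sigmaQ_mem hp _ _)

lemma Phi_mem (hp : p.Prime) {f : Poly3} (hf : f ∈ ZpP p hp) : Phi f ∈ ZpS p hp := by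
  rw [mem_ZpP] at hf
  rw [f.as_sum, map_sum]
  refine sum_mem fun m _ => ?_
  rw [Phi, aeval_monomial, Finsupp.prod_fintype _ _ (by simp)]
  refine mul_mem (CS_mem hp (hf m)) (prod_mem fun i _ => pow_mem ?_ _)
  fin_cases i
  exacts [E2s_mem hp, E4s_mem hp, E6s_mem hp]

lemma thetaS_mem (hp : p.Prime) {f : PowerSeries ℚ} (hf : f ∈ ZpS p hp) : thetaS f ∈ ZpS p hp := by
  rw [mem_ZpS] at hf ⊢
  intro n
  simp only [thetaS, PowerSeries.coeff_mk]
  exact mul_mem (natCast_mem _ _) (hf n)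

/-- congruence modulo `p ^ n` of power series with coefficients in `ℤ_(p)`. -/
def CongS (p : ℕ) (hp : p.Prime) (n : ℕ) (f g : PowerSeries ℚ) : Prop :=
  ∃ h ∈ ZpS p hp, f = g + (p : PowerSeries ℚ) ^ n * h

namespace CongS
variable {hp : p.Prime} {n : ℕ} {f g h f' g' : PowerSeries ℚ}

lemma refl (f) : CongS p hp n f f := ⟨0, zero_mem _, by simp⟩

lemma symm (H : CongS p hp n f g) : CongS p hp n g f := by
  obtain ⟨a, ha, rfl⟩ := H
  exact ⟨-a, neg_mem ha, by ring⟩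

lemma trans (H : CongS p hp n f g) (H' : CongS p hp n g h) : CongS p hp n f h := by
  obtain ⟨a, ha, rfl⟩ := H
  obtain ⟨b, hb, rfl⟩ := H'
  exact ⟨b + a, add_mem hb ha, by ring⟩

lemma add (H : CongS p hp n f g) (H' : CongS p hp n f' g') : CongS p hp n (f + f') (g + g') := by
  obtain ⟨a, ha, rfl⟩ := H
  obtain ⟨b, hb, rfl⟩ := H'
  exact ⟨a + b, add_mem ha hb, by ring⟩

lemma sum {ι : Type*} (s : Finset ι) {f g : ι → PowerSeries ℚ} (H : ∀ i ∈ s, CongS p hp n (f i) (g i)) :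
    CongS p hp n (∑ i ∈ s, f i) (∑ i ∈ s, g i) := by
  classical
  induction s using Finset.induction_on with
  | empty => simpa using refl _
  | insert a s ha ih =>
    rw [Finset.sum_insert ha, Finset.sum_insert ha]
    exact (H a (by simp)).add (ih fun i hi => H i (by simp [hi]))

lemma mul (hg : g ∈ ZpS p hp) (hg' : g' ∈ ZpS p hp) (H : CongS p hp n f g)
    (H' : CongS p hp n f' g') : CongS p hp n (f * f') (g * g') := by
  obtain ⟨a, ha, rfl⟩ := H
  obtain ⟨b, hb, rfl⟩ := H'
  exact ⟨g * b + a * g' + a * b * (p : PowerSeries ℚ) ^ n,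
    add_mem (add_mem (mul_mem hg hb) (mul_mem ha hg'))
      (mul_mem (mul_mem ha hb) (pow_mem (natCast_mem _ _) _)), by ring⟩

lemma pow (hg : g ∈ ZpS p hp) (H : CongS p hp n f g) (m : ℕ) : CongS p hp n (f ^ m) (g ^ m) := by
  induction m with
  | zero => simpa using refl _
  | succ m ih => rw [pow_succ, pow_succ]; exact mul (pow_mem hg m) hg ih H

lemma mem (hg : g ∈ ZpS p hp) (H : CongS p hp n f g) : f ∈ ZpS p hp := by
  obtain ⟨a, ha, rfl⟩ := H
  exact add_mem hg (mul_mem (pow_mem (natCast_mem _ _) _) ha)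

lemma p_mul (H : CongS p hp n f g) : CongS p hp (n + 1) (p * f) (p * g) := by
  obtain ⟨a, ha, rfl⟩ := H
  exact ⟨a, ha, by ring⟩

/-- raising to the power `p` -/
lemma pow_p (hg : g ∈ ZpS p hp) (H : CongS p hp 1 f g) : CongS p hp 2 (f ^ p) (g ^ p) := by
  obtain ⟨a, ha, rfl⟩ := H
  have hgeom := (Commute.all (g + (p : PowerSeries ℚ) ^ 1 * a) g).geom_sum₂_mul p
  have h1 : CongS p hp 1 (∑ i ∈ range p, (g + (p : PowerSeries ℚ) ^ 1 * a) ^ i * g ^ (p - 1 - i))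
      (∑ i ∈ range p, g ^ i * g ^ (p - 1 - i)) := by
    refine sum _ fun i _ => mul (pow_mem hg _) (pow_mem hg _) (pow hg ?_ _) (refl _)
    exact ⟨a, ha, rfl⟩
  obtain ⟨b, hb, hb'⟩ := h1
  have h2 : ∑ i ∈ range p, g ^ i * g ^ (p - 1 - i) = p * g ^ (p - 1) := by
    rw [Finset.sum_congr rfl (g := fun _ => g ^ (p - 1))]
    · simp
    · intro i hi
      rw [← pow_add]; congr 1
      have := Finset.mem_range.mp hi; omega
  refine ⟨(g ^ (p - 1) + b) * a, mul_mem (add_mem (pow_mem hg _) hb) ha, ?_⟩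
  rw [hb', h2] at hgeom
  linear_combination -hgeom
end CongS

end Integrality


section QPrinciple

variable {p : ℕ}

lemma ZpS_inv (hp : p.Prime) {f : PowerSeries ℚ} (hf : f ∈ ZpS p hp) {a : ℚ} (ha : a ∈ Zp p hp)
    (h : PowerSeries.constantCoeff f * a = 1) : ∃ g ∈ ZpS p hp, f * g = 1 := by
  obtain ⟨F, rfl⟩ := hf
  have hu : IsUnit F := by
    rw [PowerSeries.isUnit_iff_constantCoeff]
    refine IsUnit.of_mul_eq_one ⟨a, ha⟩ (Subtype.ext ?_)
    have e : PowerSeries.constantCoeff (PowerSeries.map (Zp p hp).subtype F) =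
      (Zp p hp).subtype (PowerSeries.constantCoeff F) := by
      rw [← PowerSeries.coeff_zero_eq_constantCoeff, ← PowerSeries.coeff_zero_eq_constantCoeff]
      simp only [PowerSeries.coeff_map]
    rw [e] at h
    exact h
  obtain ⟨G, hG⟩ := hu.exists_right_inv
  exact ⟨_, ⟨G, rfl⟩, by rw [← map_mul, hG, map_one]⟩

lemma ZpS_of_X_mul (hp : p.Prime) {f : PowerSeries ℚ} (hf : PowerSeries.X * f ∈ ZpS p hp) :
    f ∈ ZpS p hp := by
  rw [mem_ZpS] at hf ⊢
  intro n
  have := hf (n + 1)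
  rwa [PowerSeries.coeff_succ_X_mul] at this

lemma poly_principle (hp : p.Prime) {t v iv : PowerSeries ℚ} (ht : t = 1 + PowerSeries.X * v)
    (hiv : iv ∈ ZpS p hp) (hviv : v * iv = 1) (n : ℕ) :
    ∀ G : Polynomial ℚ, G.natDegree < n → Polynomial.aeval t G ∈ ZpS p hp →
      ∀ i, G.coeff i ∈ Zp p hp := by
  induction n with
  | zero => intro G h; omega
  | succ n ih =>
    intro G hG hGt
    have hdiv := Polynomial.modByMonic_add_div G (Polynomial.X - Polynomial.C 1)
    rw [add_comm] at hdiv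
    rw [Polynomial.modByMonic_X_sub_C_eq_C_eval] at hdiv
    set H := G /ₘ (Polynomial.X - Polynomial.C 1) with hH
    set b := G.eval 1 with hb
    have hGt' : Polynomial.aeval t G = PowerSeries.X * (v * Polynomial.aeval t H) + PowerSeries.C b := by
      conv_lhs => rw [← hdiv]
      simp only [map_add, map_mul, map_sub, Polynomial.aeval_X, Polynomial.aeval_C]
      rw [ht]
      simp
      ring
    have hbm : b ∈ Zp p hp := by
      have := (mem_ZpS hp _).mp hGt 0
      rw [hGt'] at this
      simpa using this
    have hHt : Polynomial.aeval t H ∈ ZpS p hp := by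
      have h1 : PowerSeries.X * (v * Polynomial.aeval t H) ∈ ZpS p hp := by
        have := sub_mem hGt (CS_mem hp hbm)
        rw [hGt'] at this
        simpa using this
      have h2 := mul_mem (ZpS_of_X_mul hp h1) hiv
      have : v * Polynomial.aeval t H * iv = Polynomial.aeval t H := by
        linear_combination Polynomial.aeval t H * hviv
      rwa [this] at h2
    by_cases h0 : G.natDegree = 0
    · rw [Polynomial.eq_C_of_natDegree_eq_zero h0] at hb ⊢
      intro i
      rw [Polynomial.coeff_C]
      split_ifs
      · simp at hb; rw [hb] at hbm; exact hbm
      · exact zero_mem _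
    have hHd : H.natDegree < n := by
      rw [hH, Polynomial.natDegree_divByMonic _ (Polynomial.monic_X_sub_C 1),
        Polynomial.natDegree_X_sub_C]
      omega
    have hHc := ih H hHd hHt
    intro i
    rw [← hdiv]
    simp only [Polynomial.coeff_add, sub_mul, Polynomial.coeff_sub, Polynomial.coeff_C_mul, one_mul,
      Polynomial.coeff_C]
    refine add_mem (sub_mem ?_ (hHc i)) ?_
    · cases i with
      | zero => simp
      | succ i => rw [Polynomial.coeff_X_mul]; exact hHc i
    · split_ifs
      exacts [hbm, zero_mem _]

/-- the `q`-expansion principle -/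
lemma q_principle (hp : p.Prime) (hp5 : 5 ≤ p) {w : ℕ} {f : Poly3} (hf : Mf w f)
    (hPhi : Phi f ∈ ZpS p hp) : f ∈ ZpP p hp := by
  obtain ⟨i4, hi4, h4⟩ := ZpS_inv hp (E4s_mem hp) (one_mem _) (by simp [cc_E4s])
  obtain ⟨i6, hi6, h6⟩ := ZpS_inv hp (E6s_mem hp) (one_mem _) (by simp [cc_E6s])
  have hc0 : PowerSeries.constantCoeff (E4s ^ 3 - E6s ^ 2) = 0 := by simp [cc_E4s, cc_E6s]
  obtain ⟨s, hs⟩ := PowerSeries.X_dvd_iff.mpr hc0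
  have hsm : s ∈ ZpS p hp := ZpS_of_X_mul hp (hs ▸ sub_mem (pow_mem (E4s_mem hp) 3) (pow_mem (E6s_mem hp) 2))
  have hs0 : PowerSeries.constantCoeff s = 1728 := by
    have h41 : PowerSeries.coeff 1 E4s = 240 := by simp [E4s, sigmaQ]
    have h61 : PowerSeries.coeff 1 E6s = -504 := by simp [E6s, sigmaQ]
    have := PowerSeries.coeff_succ_X_mul 0 s
    rw [← hs] at this
    rw [← PowerSeries.coeff_zero_eq_constantCoeff, ← this]
    simp [pow_succ, PowerSeries.coeff_one_mul, cc_E4s, cc_E6s, h41, h61]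
    norm_num
  obtain ⟨is, his, hss⟩ := ZpS_inv hp hsm (inv1728_mem hp hp5) (by rw [hs0]; norm_num)
  set t := E4s ^ 3 * i6 ^ 2 with ht
  have ht1 : t = 1 + PowerSeries.X * (s * i6 ^ 2) := by
    rw [ht]
    linear_combination i6 ^ 2 * hs + (1 + E6s * i6) * h6
  have hv : s * i6 ^ 2 * (is * E6s ^ 2) = 1 := by
    linear_combination (E6s * i6) ^ 2 * hss + (1 + E6s * i6) * h6
  have hvm : is * E6s ^ 2 ∈ ZpS p hp := mul_mem his (pow_mem (E6s_mem hp) 2)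
  obtain ⟨hw, h0⟩ := (Mf_iff w f).mp hf
  let G : Polynomial ℚ := ∑ m ∈ f.support, Polynomial.monomial (m 1 + m 2) (coeff m f)
  have hG : Polynomial.aeval t G = Phi f * (E4s * i6) ^ (w / 2) := by
    conv_rhs => rw [f.as_sum]
    simp only [G, map_sum, Finset.sum_mul]
    refine Finset.sum_congr rfl fun m hm => ?_
    rw [Phi, aeval_monomial, Finsupp.prod_fintype _ _ (by simp), Polynomial.aeval_monomial]
    have e1 := hw m hm
    have e2 := h0 m hm
    have e3 : w / 2 = 2 * m 1 + 3 * m 2 := by omega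
    rw [Fin.prod_univ_three, e2, e3, ht]
    simp only [Matrix.cons_val_zero, Matrix.cons_val_one, Matrix.cons_val, pow_zero, one_mul]
    have e4 : E6s ^ m 2 * i6 ^ m 2 = 1 := by rw [← mul_pow, h6, one_pow]
    rw [mul_assoc]
    congr 1
    calc (E4s ^ 3 * i6 ^ 2) ^ (m 1 + m 2) = (E4s ^ 3 * i6 ^ 2) ^ (m 1 + m 2) * (E6s ^ m 2 * i6 ^ m 2) := by
          rw [e4, mul_one]
      _ = _ := by ring
  have hcoef := poly_principle hp ht1 hvm hv (G.natDegree + 1) G (by omega) (by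
    rw [hG]; exact mul_mem hPhi (pow_mem (mul_mem (E4s_mem hp) hi6) _))
  rw [mem_ZpP]
  intro m
  by_cases hm : m ∈ f.support
  · have := hcoef (m 1 + m 2)
    have e : G.coeff (m 1 + m 2) = coeff m f := by
      simp only [G, Polynomial.finsetSum_coeff, Polynomial.coeff_monomial]
      rw [Finset.sum_eq_single m]
      · simp
      · intro m' hm' hne
        rw [if_neg]
        intro h
        apply hne
        have a1 := hw m hm
        have a2 := h0 m hm
        have a3 := hw m' hm'
        have a4 := h0 m' hm'
        ext i
        fin_cases i
        · change m' 0 = m 0; omega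
        · change m' 1 = m 1; omega
        · change m' 2 = m 2; omega
      · intro h; exact absurd hm h
    rw [e] at this
    exact this
  · rw [notMem_support_iff.mp hm]
    exact zero_mem (Zp p hp)

/-- divisibility by `p ^ n` is detected on `q`-expansions. -/
lemma q_principle_pow (hp : p.Prime) (hp5 : 5 ≤ p) {w : ℕ} {f g : Poly3} (hf : Mf w f)
    (hg : Mf w g) {n : ℕ} (h : CongS p hp n (Phi f) (Phi g)) :
    ∃ r ∈ ZpP p hp, f = g + (p : Poly3) ^ n * r := by
  obtain ⟨s, hs, hs'⟩ := h
  have hpn : ((p : ℚ) ^ n) ≠ 0 := pow_ne_zero _ (by exact_mod_cast hp.ne_zero)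
  have hC : (p : Poly3) ^ n * C (1 / (p : ℚ) ^ n) = 1 := by
    rw [natCast_eq_C, ← C_pow, ← C_mul, mul_one_div_cancel hpn, C_1]
  refine ⟨C (1 / (p : ℚ) ^ n) * (f - g), q_principle hp hp5 ((hf.sub hg).smul _) ?_, ?_⟩
  · have : Phi (C (1 / (p : ℚ) ^ n) * (f - g)) = s := by
      have h2 := congrArg Phi hC
      rw [map_mul, map_pow, map_natCast, map_one] at h2
      rw [map_mul, map_sub, hs']
      linear_combination s * h2
    rwa [this]
  · linear_combination -(f - g) * hC

end QPrinciple


section Final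

variable {p : ℕ}

lemma dvd_c (n m j : ℕ) (hj : j ≠ 0) : n ∣ n.choose j * m.descFactorial j := by
  rw [Nat.descFactorial_eq_factorial_mul_choose m j, ← mul_assoc, mul_comm (n.choose j),
    ← Nat.descFactorial_eq_factorial_mul_choose n j]
  apply Dvd.dvd.mul_right
  obtain ⟨j, rfl⟩ := Nat.exists_eq_succ_of_ne_zero hj
  cases n with
  | zero => simp
  | succ n => rw [Nat.succ_descFactorial_succ]; exact dvd_mul_right _ _

lemma not_mem_inv_p (hp : p.Prime) : (1 / p : ℚ) ∉ Zp p hp := by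
  rw [mem_Zp, pInt]
  simp [hp.ne_zero]

lemma inv_mem_of (hp : p.Prime) {a : ℚ} (ha : a ∈ Zp p hp) : (p * a - 1)⁻¹ ∈ Zp p hp := by
  set y := p * a - 1 with hy
  have hp0 : (p : ℚ) ≠ 0 := by exact_mod_cast hp.ne_zero
  have hym : y ∈ Zp p hp := sub_mem (mul_mem (natCast_mem _ _) ha) (one_mem _)
  have hnum : ¬ p ∣ y.num.natAbs := by
    intro h
    obtain ⟨c, hc⟩ := Int.natCast_dvd.mpr h
    apply not_mem_inv_p hp
    have h1 : y = p * (c * (1 / y.den)) := by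
      conv_lhs => rw [← Rat.num_div_den y, hc]
      push_cast; ring
    have h2 : (1 / p : ℚ) = a - c * (1 / y.den) := by
      rw [h1] at hy
      field_simp
      have : (y.den : ℚ) ≠ 0 := by exact_mod_cast y.den_nz
      field_simp at hy
      linear_combination hy
    rw [h2]
    exact sub_mem ha (mul_mem (intCast_mem _ _) (inv_mem_Zp hp _ hym))
  have h3 := inv_mem_Zp hp _ hnum
  have h4 : y⁻¹ = y.den * (y.num.sign * (1 / y.num.natAbs)) := by
    have : (y.num : ℚ) ≠ 0 := by
      intro h
      apply hnum
      have : y.num = 0 := by exact_mod_cast h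
      rw [this]; simp
    have e : (1 : ℚ) / y.num = y.num.sign * (1 / y.num.natAbs) := by
      rcases lt_or_gt_of_ne (show y.num ≠ 0 by exact_mod_cast this) with h | h
      · rw [Int.sign_eq_neg_one_of_neg h]
        have : ((y.num.natAbs : ℕ) : ℚ) = - y.num := by
          have : ((y.num.natAbs : ℕ) : ℤ) = - y.num := by omega
          rw [← Int.cast_natCast (R := ℚ), this, Int.cast_neg]
        rw [this]; push_cast; ring
      · rw [Int.sign_eq_one_of_pos h]
        have : ((y.num.natAbs : ℕ) : ℚ) = y.num := by
          have : ((y.num.natAbs : ℕ) : ℤ) = y.num := by omega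
          rw [← Int.cast_natCast (R := ℚ), this]
        rw [this]; push_cast; ring
    rw [← e]
    conv_lhs => rw [← Rat.num_div_den y]
    rw [inv_div]; ring
  rw [h4]
  exact mul_mem (natCast_mem _ _) (mul_mem (intCast_mem _ _) h3)

lemma bern_mem (hp : p.Prime) (hp5 : 5 ≤ p) :
    ∃ c ∈ Zp p hp, 2 * ((p : ℚ) - 1) / bernoulli (p - 1) = p * c := by
  have hodd := hp.eq_two_or_odd.resolve_left (by omega)
  have h2 : 2 * ((p - 1) / 2) = p - 1 := by omega
  obtain ⟨N, hN⟩ := Bernoulli.vonStaudt_clausen ((p - 1) / 2)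
  rw [h2] at hN
  have hp0 : (p : ℚ) ≠ 0 := by exact_mod_cast hp.ne_zero
  set S := (range (p - 1 + 2)).filter (fun q => q.Prime ∧ (q - 1) ∣ (p - 1)) with hS
  have hpS : p ∈ S := by
    simp only [hS, Finset.mem_filter, Finset.mem_range]
    exact ⟨by omega, hp, dvd_rfl⟩
  rw [← Finset.add_sum_erase S _ hpS] at hN
  set s := ∑ q ∈ S.erase p, (1 : ℚ) / q with hs
  have hsm : s ∈ Zp p hp := by
    refine sum_mem fun q hq => inv_mem_Zp hp q ?_
    rw [Finset.mem_erase] at hq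
    have hqp : q.Prime := (Finset.mem_filter.mp hq.2).2.1
    intro h
    exact hq.1 ((Nat.prime_dvd_prime_iff_eq hp hqp).mp h).symm
  have ha : (N : ℚ) - s ∈ Zp p hp := sub_mem (intCast_mem _ _) hsm
  have hB : bernoulli (p - 1) = (p * (N - s) - 1) / p := by
    field_simp
    have h1 : (p : ℚ) * (1 / p) = 1 := by field_simp
    linear_combination (-p : ℚ) * hN - h1
  refine ⟨2 * (p - 1) * (p * (N - s) - 1)⁻¹, ?_, ?_⟩
  · refine mul_mem (mul_mem ?_ (sub_mem (natCast_mem _ _) (one_mem _))) (inv_mem_of hp ha)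
    exact_mod_cast natCast_mem (Zp p hp) 2
  · rw [hB, div_div_eq_mul_div, div_eq_mul_inv]; ring

lemma EAs_cong (hp : p.Prime) (hp5 : 5 ≤ p) : CongS p hp 1 (EAs p) 1 := by
  obtain ⟨c, hc, hc'⟩ := bern_mem hp hp5
  refine ⟨PowerSeries.mk fun n => if n = 0 then 0 else -c * sigmaQ (p - 2) n, ?_, ?_⟩
  · rw [mem_ZpS]
    intro n
    rw [PowerSeries.coeff_mk]
    split_ifs
    · exact zero_mem _
    · exact mul_mem (neg_mem hc) (sigmaQ_mem hp _ _)
  · have : (p : PowerSeries ℚ) ^ 1 = PowerSeries.C (p : ℚ) := by simp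
    rw [this]
    ext n
    simp only [EAs, PowerSeries.coeff_mk, map_add, PowerSeries.coeff_C_mul, PowerSeries.coeff_one, hc']
    split_ifs <;> ring

lemma CongS.theta {hp : p.Prime} {n : ℕ} {f g : PowerSeries ℚ} (h : CongS p hp n f g) :
    CongS p hp n (thetaS f) (thetaS g) := by
  obtain ⟨a, ha, rfl⟩ := h
  refine ⟨thetaS a, thetaS_mem hp ha, ?_⟩
  have : (p : PowerSeries ℚ) ^ n = PowerSeries.C ((p : ℚ) ^ n) := by simp
  rw [thetaS_add, thetaS_mul, this, thetaS_C]; ring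

lemma thetaS_iter (f : PowerSeries ℚ) (n m : ℕ) :
    PowerSeries.coeff m (thetaS^[n] f) = (m : ℚ) ^ n * PowerSeries.coeff m f := by
  induction n with
  | zero => simp
  | succ n ih =>
    rw [Function.iterate_succ_apply']
    simp only [thetaS, PowerSeries.coeff_mk] at *
    rw [ih]; ring

lemma pow_cong (hp : p.Prime) (m : ℕ) : ∃ c : ℤ, ((m : ℤ) ^ (p ^ 2)) - m ^ p = p ^ 2 * c := by
  haveI := Fact.mk hp
  have h1 : (p : ℤ) ∣ (m : ℤ) ^ p - m := by
    rw [← ZMod.intCast_zmod_eq_zero_iff_dvd]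
    push_cast
    rw [ZMod.pow_card, sub_self]
  have := dvd_sub_pow_of_dvd_sub h1 1
  rw [pow_one, ← pow_mul, ← pow_two] at this
  exact this

lemma theta_cong (hp : p.Prime) {f : PowerSeries ℚ} (hf : f ∈ ZpS p hp) :
    CongS p hp 2 (thetaS^[p ^ 2] f) (thetaS^[p] f) := by
  choose c hc using pow_cong hp
  refine ⟨PowerSeries.mk fun m => c m * PowerSeries.coeff m f, ?_, ?_⟩
  · rw [mem_ZpS] at hf ⊢
    intro n
    rw [PowerSeries.coeff_mk]
    exact mul_mem (intCast_mem _ _) (hf n)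
  · have : (p : PowerSeries ℚ) ^ 2 = PowerSeries.C ((p : ℚ) ^ 2) := by simp
    rw [this]
    ext m
    rw [map_add, PowerSeries.coeff_C_mul, thetaS_iter, thetaS_iter, PowerSeries.coeff_mk]
    have h : ((m : ℚ) ^ (p ^ 2)) - m ^ p = p ^ 2 * c m := by exact_mod_cast hc m
    linear_combination PowerSeries.coeff m f * h

lemma Phi_Dop_iter (f : Poly3) (n : ℕ) : Phi (Dop^[n] f) = thetaS^[n] (Phi f) := by
  induction n with
  | zero => simp
  | succ n ih => rw [Function.iterate_succ_apply', Function.iterate_succ_apply', Phi_Dop, ih]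

lemma Pd_mem (hp : p.Prime) (hp5 : 5 ≤ p) : Pd ∈ ZpP p hp :=
  mul_mem (C_mem hp (twelfth_mem hp hp5)) (X_mem hp 0)

lemma C_natCast_eq (n : ℕ) : (C ((n : ℕ) : ℚ) : Poly3) = (n : Poly3) := by simp

theorem main_aux (hp : p.Prime) (hp5 : 5 ≤ p)
    (A : Poly3) (hA : Mf ((p - 1 : ℕ) : ℤ) A) (hAint : A ∈ ZpP p hp) (hAPhi : Phi A = EAs p)
    (k : ℕ) (hk : 0 < k) (F : Poly3) (hF : Mf k F) (hFint : F ∈ ZpP p hp) :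
    InIdealPow p A 2 (Dop^[p ^ 2] F) := by
  have hFm := Fseq_mem hp hp5 hFint k
  -- step 1: `D^{p^2} F` is congruent to `F_{p^2}`
  have step1 : ∃ G₀ ∈ ZpP p hp, Dop^[p ^ 2] F = Fseq k F (p ^ 2) + (p : Poly3) ^ 2 * G₀ := by
    rw [CK_formula hk hF]
    choose c hc using fun j : ℕ => dvd_c (p ^ 2) (k + p ^ 2 - 1) (j + 1) (Nat.succ_ne_zero j)
    obtain ⟨N, hN⟩ : ∃ N, p ^ 2 = N + 1 := ⟨p ^ 2 - 1, by have := hp.pos; have := pow_pos this 2; omega⟩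
    refine ⟨∑ x ∈ antidiagonal N, (c x.1 : Poly3) * Pd ^ (x.1 + 1) * Fseq k F x.2, ?_, ?_⟩
    · exact sum_mem fun x _ => mul_mem (mul_mem (natCast_mem _ _) (pow_mem (Pd_mem hp hp5) _)) (hFm _)
    · have hNN : antidiagonal (p ^ 2) = antidiagonal (N + 1) := by rw [hN]
      rw [hNN, Finset.Nat.sum_antidiagonal_succ, Finset.mul_sum]
      congr 1
      · rw [hN]; simp
      · refine Finset.sum_congr rfl fun x _ => ?_
        simp only
        rw [hc, C_natCast_eq]
        push_cast; ring
  obtain ⟨G₀, hG₀, h1⟩ := step1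
  -- step 2: the form `B`
  set B := dS A with hB
  have hBmf : Mf ((p + 1 : ℕ) : ℤ) B := by
    have := hA.dS
    have e : ((p - 1 : ℕ) : ℤ) + 2 = ((p + 1 : ℕ) : ℤ) := by have := hp.pos; omega
    rwa [e] at this
  have hBm : B ∈ ZpP p hp := dS_mem hp hp5 hAint
  have hEA := EAs_cong hp hp5
  have hPd : Phi Pd ∈ ZpS p hp := Phi_mem hp (Pd_mem hp hp5)
  have hBPhi : CongS p hp 1 (Phi B) (Phi Pd) := by
    have e1 : B = Dop A - C (((p - 1 : ℕ) : ℚ)) * Pd * A := by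
      rw [Dop_eq_dS hA, div_eq_mul_one_div, C_mul, Pd]; ring
    have e2 : Phi B = thetaS (EAs p) + (1 + p * (-1)) * Phi Pd * EAs p := by
      rw [e1, map_sub, Phi_Dop, map_mul, map_mul, hAPhi, C_natCast_eq, map_natCast,
        Nat.cast_sub hp.pos]
      push_cast; ring
    have e3 : Phi Pd = 0 + 1 * Phi Pd * 1 := by ring
    rw [e2]
    conv_rhs => rw [e3]
    refine CongS.add ?_ (CongS.mul ?_ (one_mem _) (CongS.mul (one_mem _) hPd ?_ (CongS.refl _)) hEA)
    · have := hEA.theta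
      rwa [show thetaS (1 : PowerSeries ℚ) = 0 by simpa using thetaS_C 1] at this
    · simpa using hPd
    · exact ⟨-1, neg_mem (one_mem _), by ring⟩
  -- step 3: coefficients for `n = p`
  choose c hc using fun j : ℕ => dvd_c p (k + p - 1) (j + 1) (Nat.succ_ne_zero j)
  obtain ⟨N, hN⟩ : ∃ N, p = N + 1 := ⟨p - 1, by have := hp.pos; omega⟩
  have hDp : Dop^[p] F = Fseq k F p +
      p * ∑ x ∈ antidiagonal N, (c x.1 : Poly3) * Pd ^ (x.1 + 1) * Fseq k F x.2 := by
    rw [CK_formula hk hF]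
    have hNN : antidiagonal p = antidiagonal (N + 1) := by rw [← hN]
    rw [hNN, Finset.Nat.sum_antidiagonal_succ, Finset.mul_sum]
    congr 1
    · rw [← hN]; simp
    · refine Finset.sum_congr rfl fun x _ => ?_
      simp only
      rw [hc, C_natCast_eq]
      push_cast; ring
  let T₁ : Poly3 := ∑ x ∈ antidiagonal N, (c x.1 : Poly3) * B ^ (x.1 + 1) * A ^ (2 * p - (x.1 + 1)) * Fseq k F x.2
  let T : Poly3 := A ^ (2 * p) * Fseq k F p + p * T₁
  have hTmf : Mf ((k + 2 * p ^ 2 : ℕ) : ℤ) T := by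
    refine Mf.add ?_ ?_
    · have := (hA.pow (2 * p)).mul (Fseq_Mf hF p)
      convert! this using 1
      have := hp.pos
      push_cast [Nat.cast_sub this]
      ring
    · rw [natCast_eq_C]
      refine (Mf.sum _ fun x hx => ?_).smul _
      have hx' := Finset.HasAntidiagonal.mem_antidiagonal.mp hx
      have := (((hBmf.pow (x.1 + 1)).smul (c x.1 : ℚ)).mul (hA.pow (2 * p - (x.1 + 1)))).mul (Fseq_Mf hF x.2)
      rw [C_natCast_eq] at this
      convert! this using 1
      have := hp.pos
      have hle : x.1 + 1 ≤ 2 * p := by omega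
      have hx2 : (x.2 : ℤ) = p - 1 - x.1 := by omega
      push_cast [Nat.cast_sub this, Nat.cast_sub hle]
      rw [hx2]
      ring
  -- step 4: the congruence of `q`-expansions
  have hcong : CongS p hp 2 (Phi (Fseq k F (p ^ 2))) (Phi T) := by
    have a1 : CongS p hp 2 (Phi (Fseq k F (p ^ 2))) (Phi (Dop^[p ^ 2] F)) := by
      rw [h1]
      refine CongS.symm ⟨Phi G₀, Phi_mem hp hG₀, ?_⟩
      simp
    have a2 : CongS p hp 2 (Phi (Dop^[p ^ 2] F)) (Phi (Dop^[p] F)) := by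
      rw [Phi_Dop_iter, Phi_Dop_iter]
      exact theta_cong hp (Phi_mem hp hFint)
    refine (a1.trans a2).trans (CongS.symm ?_)
    rw [hDp]
    simp only [T, map_add, map_mul, map_pow, map_natCast, hAPhi]
    refine CongS.add ?_ (CongS.p_mul ?_)
    · have := CongS.mul (pow_mem (pow_mem (one_mem _) _) _) (Phi_mem hp (hFm p))
        (CongS.pow (pow_mem (one_mem _) _) (CongS.pow_p (one_mem _) hEA) 2) (CongS.refl (Phi (Fseq k F p)))
      simpa [← pow_mul, mul_comm] using this
    · simp only [T₁, map_sum]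
      refine CongS.sum _ fun x hx => ?_
      simp only [map_mul, map_pow, map_natCast, hAPhi]
      have b1 := CongS.pow hPd hBPhi (x.1 + 1)
      have b2 := CongS.pow (one_mem _) hEA (2 * p - (x.1 + 1))
      have b3 := CongS.mul (mul_mem (mul_mem (natCast_mem _ _) (pow_mem hPd _)) (pow_mem (one_mem _) _))
        (Phi_mem hp (hFm x.2))
        (CongS.mul (mul_mem (natCast_mem _ _) (pow_mem hPd _)) (pow_mem (one_mem _) _)
          (CongS.mul (natCast_mem _ _) (pow_mem hPd _) (CongS.refl (c x.1 : PowerSeries ℚ)) b1) b2)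
        (CongS.refl (Phi (Fseq k F x.2)))
      simpa using b3
  obtain ⟨r, hr, hr'⟩ := q_principle_pow hp hp5 (Fseq_Mf hF (p ^ 2)) hTmf hcong
  -- step 5: conclusion
  let G₁ : Poly3 := ∑ x ∈ antidiagonal N, (c x.1 : Poly3) * B ^ (x.1 + 1) * A ^ (p - (x.1 + 1)) * Fseq k F x.2
  have hT₁ : T₁ = A ^ p * G₁ := by
    simp only [T₁, G₁, Finset.mul_sum]
    refine Finset.sum_congr rfl fun x hx => ?_
    have hx' := Finset.HasAntidiagonal.mem_antidiagonal.mp hx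
    rw [show 2 * p - (x.1 + 1) = p + (p - (x.1 + 1)) by omega, pow_add]
    ring
  have hG₁ : G₁ ∈ ZpP p hp := sum_mem fun x _ =>
    mul_mem (mul_mem (mul_mem (natCast_mem _ _) (pow_mem hBm _)) (pow_mem hAint _)) (hFm _)
  refine ⟨fun i => if i = 0 then r + G₀ else if i = 1 then G₁ else Fseq k F p, ?_, ?_⟩
  · intro i
    rw [← mem_ZpP hp]
    dsimp only
    split_ifs
    exacts [add_mem hr hG₀, hG₁, hFm p]
  · rw [h1, hr']
    simp only [T, hT₁, Finset.sum_range_succ, Finset.sum_range_zero]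
    simp
    ring

end Final

theorem stmt_13 (p : ℕ) (hp : p.Prime) (hp5 : 5 ≤ p)
    (A : Poly3) (hAiso : Isobaric (p - 1) A) (hAnoP : NoP A)
    (hAint : polyPInt p A) (hAPhi : Phi A = EAs p)
    (k : ℕ) (hk : 0 < k) (F : Poly3) (hFiso : Isobaric k F) (hFnoP : NoP F)
    (hFint : polyPInt p F) :
    InIdealPow p A 2 (Dop^[p ^ 2] F) := by
  exact main_aux hp hp5 A ((Mf_iff _ _).mpr ⟨hAiso, hAnoP⟩) ((mem_ZpP hp A).mpr hAint) hAPhi k hk F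
    ((Mf_iff _ _).mpr ⟨hFiso, hFnoP⟩) ((mem_ZpP hp F).mpr hFint)
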